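/- The pushforward of the probability measure μ_s^n under the map z ↦ z^{-1} on GL(n, Q_p) (defined μ_s^n-almost everywhere) has density |det z|_p^s with respect to μ_s^n: dμ_s^n(z^{-1}) = |det z|_p^s dμ_s^n(z). -/

import Mathlib

open MeasureTheory Matrix
open scoped ENNReal NNReal BigOperators

variable {p : ℕ} [Fact p.Prime]

noncomputable instance : MeasurableSpace ℚ_[p] := borel _
instance : BorelSpace ℚ_[p] := ⟨rfl⟩
noncomputable instance (n m : ℕ) : MeasurableSpace (Matrix (Fin n) (Fin m) ℚ_[p]) :=
  (inferInstance : MeasurableSpace (Fin n → Fin m → ℚ_[p]))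
instance (n m : ℕ) : BorelSpace (Matrix (Fin n) (Fin m) ℚ_[p]) :=
  (inferInstance : BorelSpace (Fin n → Fin m → ℚ_[p]))

/-- A matrix over `ℚ_[p]` lies in `GL(·, ℤ_p)`: it has integral entries and an
integral two-sided inverse. -/
def IsGLZp {m : Type*} [Fintype m] [DecidableEq m] (A : Matrix m m ℚ_[p]) : Prop :=
  (∀ i j, ‖A i j‖ ≤ 1) ∧ ∃ B : Matrix m m ℚ_[p],
    (∀ i j, ‖B i j‖ ≤ 1) ∧ A * B = 1 ∧ B * A = 1

/-- Smith normal form over `ℤ_p`: `z = A * diagonal d * B` with `A, B ∈ GL(n, ℤ_p)`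
and each diagonal entry `d j` equal to `0` or to a power `p^(-k_j)` of `p`. -/
def IsSmith {n : ℕ} (z : Matrix (Fin n) (Fin n) ℚ_[p])
    (A : Matrix (Fin n) (Fin n) ℚ_[p]) (d : Fin n → ℚ_[p])
    (B : Matrix (Fin n) (Fin n) ℚ_[p]) : Prop :=
  IsGLZp A ∧ IsGLZp B ∧ (∀ j, d j = 0 ∨ ∃ k : ℤ, d j = (p : ℚ_[p]) ^ (-k)) ∧
    z = A * Matrix.diagonal d * B

open Classical in
/-- `γ(z) = ∏_{k_j > 0} p^{k_j}`, computed from a Smith normal form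
`z = A diag(p^{-k_1},…,p^{-k_n}) B`: indeed `max(‖d j‖, 1) = p^{k_j}` when `k_j > 0`
and `= 1` otherwise. -/
noncomputable def gammaFn {n : ℕ} (z : Matrix (Fin n) (Fin n) ℚ_[p]) : ℝ :=
  if h : ∃ A d B, IsSmith z A d B then ∏ j, max ‖h.choose_spec.choose j‖ 1 else 1

/-- The constant `c(n, α) = ∏_{j=1}^n (1-p^{-α+n-j})/(1-p^{-α+n+j-1})`. -/
noncomputable def cConst (p n : ℕ) (α : ℝ) : ℝ :=
  ∏ j ∈ Finset.range n,
    (1 - (p : ℝ) ^ (-α + n - (j + 1 : ℕ))) / (1 - (p : ℝ) ^ (-α + n + (j + 1 : ℕ) - 1))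

/-- The Hua measure `μ_s^n` with density `c(n, s+2n)^{-1} γ(z)^{-s-2n}`
against the additive Haar measure `vol`. -/
noncomputable def huaMeasure (p : ℕ) [Fact p.Prime] (n : ℕ) (s : ℝ)
    (vol : Measure (Matrix (Fin n) (Fin n) ℚ_[p])) :
    Measure (Matrix (Fin n) (Fin n) ℚ_[p]) :=
  vol.withDensity fun z =>
    ENNReal.ofReal ((cConst p n (s + 2 * n))⁻¹ * gammaFn z ^ (-(s + 2 * n)))


/-! ### Topological instances on the space of matrices -/

instance instSecondCountableMatQ (n : ℕ) :
    SecondCountableTopology (Matrix (Fin n) (Fin n) ℚ_[p]) :=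
  (inferInstance : SecondCountableTopology (Fin n → Fin n → ℚ_[p]))
instance instLocallyCompactMatQ (n : ℕ) :
    LocallyCompactSpace (Matrix (Fin n) (Fin n) ℚ_[p]) :=
  (inferInstance : LocallyCompactSpace (Fin n → Fin n → ℚ_[p]))

/-! ### Volumes of balls in `ℚ_p` -/

lemma ball_step (κ : Measure ℚ_[p]) [κ.IsAddHaarMeasure] (k : ℤ) :
    κ {x | ‖x‖ ≤ (p : ℝ) ^ k} = p * κ {x | ‖x‖ ≤ (p : ℝ) ^ (k - 1)} := by
  have hp : (0 : ℝ) < p := by exact_mod_cast (Fact.out : p.Prime).pos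
  have hp0 : (p : ℚ_[p]) ≠ 0 := by exact_mod_cast (Fact.out : p.Prime).ne_zero
  have hU : {x : ℚ_[p] | ‖x‖ ≤ (p : ℝ) ^ k} =
      ⋃ i ∈ Finset.range p, (fun x => -((i : ℚ_[p]) * (p : ℚ_[p]) ^ (-k)) + x) ⁻¹'
        {x | ‖x‖ ≤ (p : ℝ) ^ (k - 1)} := by
    ext x
    simp only [Set.mem_ofPred_eq, Set.mem_iUnion, Set.mem_preimage, Finset.mem_range, exists_prop]
    constructor
    · intro hx
      have hy : ‖(p : ℚ_[p]) ^ k * x‖ ≤ 1 := by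
        rw [norm_mul, Padic.norm_p_zpow]
        calc (p : ℝ) ^ (-k) * ‖x‖ ≤ (p : ℝ) ^ (-k) * (p : ℝ) ^ k := by gcongr
          _ = 1 := by rw [← zpow_add₀ hp.ne']; simp
      obtain ⟨i, hi, hm⟩ := PadicInt.exists_mem_range (⟨_, hy⟩ : ℤ_[p])
      refine ⟨i, hi, ?_⟩
      rw [IsLocalRing.mem_maximalIdeal, PadicInt.mem_nonunits, PadicInt.norm_def] at hm
      rw [Padic.norm_le_pow_iff_norm_lt_pow_add_one, sub_add_cancel]
      have : -((i : ℚ_[p]) * (p : ℚ_[p]) ^ (-k)) + x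
          = (p : ℚ_[p]) ^ (-k) * ((p : ℚ_[p]) ^ k * x - i) := by
        rw [mul_sub, ← mul_assoc, ← zpow_add₀ hp0]; simp; ring
      rw [this, norm_mul, Padic.norm_p_zpow, neg_neg]
      have h2 : ‖(p : ℚ_[p]) ^ k * x - i‖ < 1 := hm
      calc _ < (p : ℝ) ^ k * 1 := by gcongr
        _ = _ := mul_one _
    · rintro ⟨i, hi, h⟩
      have hx : x = (i : ℚ_[p]) * (p : ℚ_[p]) ^ (-k)
        + (-((i : ℚ_[p]) * (p : ℚ_[p]) ^ (-k)) + x) := by ring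
      rw [hx]
      refine (Padic.nonarchimedean _ _).trans (max_le ?_ (h.trans ?_))
      · rw [norm_mul, Padic.norm_p_zpow, neg_neg]
        have := Padic.norm_int_le_one (p := p) (i : ℤ)
        simp only [Int.cast_natCast] at this
        calc _ ≤ 1 * (p : ℝ) ^ k := by gcongr
          _ = _ := one_mul _
      · apply zpow_le_zpow_right₀ _ (by omega)
        exact_mod_cast (Fact.out : p.Prime).one_lt.le
  have hmeas : MeasurableSet {x : ℚ_[p] | ‖x‖ ≤ (p : ℝ) ^ (k - 1)} :=
    (isClosed_le continuous_norm continuous_const).measurableSet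
  rw [hU, measure_biUnion_finset]
  · simp only [measure_preimage_add, Finset.sum_const, Finset.card_range, nsmul_eq_mul]
  · intro i hi j hj hij
    rw [Function.onFun, Set.disjoint_left]
    intro x hx1 hx2
    simp only [Set.mem_ofPred_eq, Set.mem_preimage] at hx1 hx2
    apply hij
    have h3 : ‖((i : ℚ_[p]) - j) * (p : ℚ_[p]) ^ (-k)‖ < (p : ℝ) ^ k := by
      have : ((i : ℚ_[p]) - j) * (p : ℚ_[p]) ^ (-k) = 
        (-((j : ℚ_[p]) * (p : ℚ_[p]) ^ (-k)) + x) - (-((i : ℚ_[p]) * (p : ℚ_[p]) ^ (-k)) + x) := by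
        ring
      rw [this]
      have h4 : ∀ y : ℚ_[p], ‖y‖ ≤ (p : ℝ) ^ (k-1) → ‖y‖ < (p : ℝ) ^ k := by
        intro y hy
        rwa [Padic.norm_le_pow_iff_norm_lt_pow_add_one, sub_add_cancel] at hy
      apply h4
      rw [sub_eq_add_neg]
      exact (Padic.nonarchimedean _ _).trans (max_le hx2 (by rwa [norm_neg]))
    rw [norm_mul, Padic.norm_p_zpow, neg_neg] at h3
    have h5 : ‖(((i : ℤ) - (j : ℤ) : ℤ) : ℚ_[p])‖ < 1 := by
      push_cast
      have : (0 : ℝ) < (p : ℝ) ^ k := by positivity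
      nlinarith
    rw [Padic.norm_intCast_lt_one_iff] at h5
    have hi' := Finset.mem_coe.1 hi
    have hj' := Finset.mem_coe.1 hj
    rw [Finset.mem_range] at hi' hj'
    have := Int.eq_zero_of_abs_lt_dvd h5 (by rw [abs_lt]; omega)
    omega
  · intro i _
    exact hmeas.preimage (by fun_prop)

lemma ball_vol (κ : Measure ℚ_[p]) [κ.IsAddHaarMeasure] (h1 : κ {x | ‖x‖ ≤ 1} = 1) (k : ℤ) :
    κ {x | ‖x‖ ≤ (p : ℝ) ^ k} = ENNReal.ofReal ((p : ℝ) ^ k) := by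
  have hp : (0 : ℝ) < p := by exact_mod_cast (Fact.out : p.Prime).pos
  have hpE : (p : ℝ≥0∞) = ENNReal.ofReal p := by simp
  induction k with
  | zero => simpa using h1
  | succ i ih =>
    rw [ball_step, add_sub_cancel_right, ih, hpE, ← ENNReal.ofReal_mul hp.le, zpow_add_one₀ hp.ne',
      mul_comm]
  | pred i ih =>
    rw [ball_step, hpE] at ih
    have h : ENNReal.ofReal ((p : ℝ) ^ (-(i : ℤ))) =
        ENNReal.ofReal p * ENNReal.ofReal ((p : ℝ) ^ (-(i : ℤ) - 1)) := by
      rw [← ENNReal.ofReal_mul hp.le, zpow_sub_one₀ hp.ne']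
      congr 1; field_simp
    rw [h] at ih
    exact (ENNReal.mul_right_inj (by simpa using hp.ne') (by simp)).1 ih

lemma ball_vol_norm (κ : Measure ℚ_[p]) [κ.IsAddHaarMeasure] (h1 : κ {x | ‖x‖ ≤ 1} = 1)
    (a : ℚ_[p]) (ha : a ≠ 0) :
    κ {x | ‖a * x‖ ≤ 1} = ENNReal.ofReal ‖a‖⁻¹ := by
  obtain ⟨m, hm⟩ := Padic.padicNormE.image ha
  have hm' : ‖a‖ = (p : ℝ) ^ (-m) := by rw [hm]; simp
  have hp : (0 : ℝ) < p := by exact_mod_cast (Fact.out : p.Prime).pos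
  have : {x : ℚ_[p] | ‖a * x‖ ≤ 1} = {x | ‖x‖ ≤ (p : ℝ) ^ m} := by
    ext x
    simp only [Set.mem_ofPred_eq, norm_mul, hm', _root_.zpow_neg]
    rw [inv_mul_le_iff₀ (by positivity), mul_one]
  rw [this, ball_vol κ h1, hm', ← _root_.zpow_neg, neg_neg]

lemma ball_vol_max (κ : Measure ℚ_[p]) [κ.IsAddHaarMeasure] (h1 : κ {x | ‖x‖ ≤ 1} = 1)
    (a : ℚ_[p]) :
    κ {x | ‖x‖ ≤ 1 ∧ ‖a * x‖ ≤ 1} = ENNReal.ofReal (max ‖a‖ 1)⁻¹ := by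
  rcases le_total ‖a‖ 1 with h | h
  · have : {x : ℚ_[p] | ‖x‖ ≤ 1 ∧ ‖a * x‖ ≤ 1} = {x | ‖x‖ ≤ 1} := by
      ext x
      simp only [Set.mem_ofPred_eq, norm_mul, and_iff_left_iff_imp]
      intro hx
      exact mul_le_one₀ h (norm_nonneg _) hx
    rw [this, h1, max_eq_right h]; simp
  · have : {x : ℚ_[p] | ‖x‖ ≤ 1 ∧ ‖a * x‖ ≤ 1} = {x | ‖a * x‖ ≤ 1} := by
      ext x
      simp only [Set.mem_ofPred_eq, norm_mul, and_iff_right_iff_imp]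
      intro hx
      refine le_trans ?_ hx
      exact le_mul_of_one_le_left (norm_nonneg _) h
    rw [this, ball_vol_norm κ h1, max_eq_left h]
    rintro rfl
    simp at h
    linarith

/-- The normalised Haar measure on `ℚ_p`. -/
lemma exists_kappa : ∃ κ : Measure ℚ_[p], κ.IsAddHaarMeasure ∧ κ {x | ‖x‖ ≤ 1} = 1 := by
  let K : TopologicalSpace.PositiveCompacts ℚ_[p] :=
    ⟨⟨Metric.closedBall 0 1, isCompact_closedBall _ _⟩, by
      refine ⟨0, mem_interior_iff_mem_nhds.2 (Metric.closedBall_mem_nhds _ one_pos)⟩⟩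
  refine ⟨Measure.addHaarMeasure K, inferInstance, ?_⟩
  have : {x : ℚ_[p] | ‖x‖ ≤ 1} = (K : Set ℚ_[p]) := by
    ext x; exact mem_closedBall_zero_iff.symm
  rw [this, Measure.addHaarMeasure_self]

/-! ### Existence of Smith normal forms -/

lemma isGLZp_of_padicInt {n : ℕ} (A B : Matrix (Fin n) (Fin n) ℤ_[p]) (h : A * B = 1) :
    IsGLZp (A.map (algebraMap ℤ_[p] ℚ_[p])) := by
  have h' : B * A = 1 := mul_eq_one_comm.1 h
  refine ⟨fun i j => (A i j).norm_le_one, B.map (algebraMap ℤ_[p] ℚ_[p]),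
    fun i j => (B i j).norm_le_one, ?_, ?_⟩
  · rw [← Matrix.map_mul, h, Matrix.map_one _ (map_zero _) (map_one _)]
  · rw [← Matrix.map_mul, h', Matrix.map_one _ (map_zero _) (map_one _)]

lemma smith_int {n : ℕ} (Z : Matrix (Fin n) (Fin n) ℤ_[p]) (hZ : Z.det ≠ 0) :
    ∃ (A A' B B' : Matrix (Fin n) (Fin n) ℤ_[p]) (a : Fin n → ℤ_[p]),
      A * A' = 1 ∧ B * B' = 1 ∧ (∀ i, a i ≠ 0) ∧ Z = A * Matrix.diagonal a * B := by
  have hinj : Function.Injective (Matrix.toLin' Z) := by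
    have := Matrix.mulVec_injective_of_det_ne_zero hZ
    intro x y hxy
    exact this (by simpa using hxy)
  obtain ⟨b, a, ab, hab⟩ := Submodule.exists_smith_normal_form_of_rank_eq
    (N := LinearMap.range (Matrix.toLin' Z)) (Pi.basisFun ℤ_[p] (Fin n))
    (LinearMap.finrank_range_of_inj hinj)
  have hmem : ∀ i, ∃ c, Matrix.toLin' Z c = ab i := fun i => (ab i).2
  choose C hC using hmem
  let A : Matrix (Fin n) (Fin n) ℤ_[p] := (Pi.basisFun ℤ_[p] (Fin n)).toMatrix b
  let A' : Matrix (Fin n) (Fin n) ℤ_[p] := b.toMatrix (Pi.basisFun ℤ_[p] (Fin n))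
  let w : Fin n → LinearMap.range (Matrix.toLin' Z) := fun j =>
    ⟨Matrix.toLin' Z (Pi.single j 1), LinearMap.mem_range_self _ _⟩
  let B : Matrix (Fin n) (Fin n) ℤ_[p] := ab.toMatrix w
  let B' : Matrix (Fin n) (Fin n) ℤ_[p] := Matrix.of fun i j => C j i
  have hZ1 : Z = A * Matrix.diagonal a * B := by
    ext i j
    have h1 : Z i j = (Matrix.toLin' Z (Pi.single j 1)) i := by simp
    have h2 : (Matrix.toLin' Z (Pi.single j 1)) = ∑ k, B k j • (a k • b k) := by
      have := congrArg Subtype.val (ab.sum_toMatrix_smul_self w j)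
      rw [Submodule.coe_sum] at this
      simp only [Submodule.coe_smul, hab] at this
      exact this.symm
    rw [h1, h2, Matrix.mul_apply, Finset.sum_apply]
    refine Finset.sum_congr rfl fun k _ => ?_
    simp [A, Matrix.mul_diagonal, Module.Basis.toMatrix_apply]
    ring
  have hZ2 : Z * B' = A * Matrix.diagonal a := by
    ext i j
    have := congrFun (hC j) i
    rw [hab] at this
    rw [Matrix.mul_diagonal]
    simp only [Matrix.toLin'_apply, Matrix.mulVec, dotProduct, Pi.smul_apply, smul_eq_mul] at this
    rw [Matrix.mul_apply]
    simp only [B', A, Matrix.of_apply, Module.Basis.toMatrix_apply, Pi.basisFun_repr]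
    rw [this, mul_comm]
  have hdet : (A * Matrix.diagonal a).det ≠ 0 := by
    intro h
    apply hZ
    rw [hZ1, Matrix.det_mul, h, zero_mul]
  refine ⟨A, A', B, B', a, Module.Basis.toMatrix_mul_toMatrix_flip _ _, ?_, ?_, hZ1⟩
  · have h3 : (A * Matrix.diagonal a) * (B * B') = (A * Matrix.diagonal a) * 1 := by
      rw [← Matrix.mul_assoc, ← hZ1, hZ2, Matrix.mul_one]
    ext i j
    have key : ∀ T M : Matrix (Fin n) (Fin n) ℤ_[p], T.adjugate * (T * M) = T.det • M := by
      intro T M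
      rw [← Matrix.mul_assoc, Matrix.adjugate_mul, Matrix.smul_mul, Matrix.one_mul]
    have h4 := congrArg (fun M => (A * Matrix.diagonal a).adjugate * M) h3
    simp only [key] at h4
    have h5 := congrFun (congrFun h4 i) j
    simp only [Matrix.smul_apply, smul_eq_mul] at h5
    exact mul_left_cancel₀ hdet h5
  · intro i hi
    apply hdet
    rw [Matrix.det_mul, Matrix.det_diagonal, Finset.prod_eq_zero (Finset.mem_univ i) hi, mul_zero]

lemma exists_smith {n : ℕ} (z : Matrix (Fin n) (Fin n) ℚ_[p]) (hz : z.det ≠ 0) :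
    ∃ A d B, IsSmith z A d B ∧ ∀ i, d i ≠ 0 := by
  have hp0 : (p : ℚ_[p]) ≠ 0 := by exact_mod_cast (Fact.out : p.Prime).ne_zero
  have hN : ∃ N : ℕ, ∀ i j, ‖(p : ℚ_[p]) ^ N * z i j‖ ≤ 1 := by
    have hp1 : (1 : ℝ) < p := by exact_mod_cast (Fact.out : p.Prime).one_lt
    obtain ⟨N, hN⟩ := pow_unbounded_of_one_lt (∑ i, ∑ j, ‖z i j‖) hp1
    refine ⟨N, fun i j => ?_⟩
    rw [norm_mul, Padic.norm_p_pow, _root_.zpow_neg, zpow_natCast, inv_mul_le_iff₀ (by positivity), mul_one]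
    refine le_trans ?_ hN.le
    calc ‖z i j‖ ≤ ∑ j, ‖z i j‖ :=
          Finset.single_le_sum (f := fun j => ‖z i j‖) (fun _ _ => norm_nonneg _) (Finset.mem_univ j)
      _ ≤ _ := Finset.single_le_sum (f := fun i => ∑ j, ‖z i j‖)
          (fun _ _ => Finset.sum_nonneg fun _ _ => norm_nonneg _) (Finset.mem_univ i)
  obtain ⟨N, hN⟩ := hN
  let Z : Matrix (Fin n) (Fin n) ℤ_[p] := fun i j => ⟨_, hN i j⟩
  have hZz : Z.map (algebraMap ℤ_[p] ℚ_[p]) = (p : ℚ_[p]) ^ N • z := by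
    ext i j; rfl
  have hZ : Z.det ≠ 0 := by
    intro h
    have h2 : (Z.map (algebraMap ℤ_[p] ℚ_[p])).det = 0 := by
      have := (algebraMap ℤ_[p] ℚ_[p]).map_det Z
      rw [h, map_zero] at this
      exact this.symm
    rw [hZz, Matrix.det_smul] at h2
    exact hz ((mul_eq_zero.1 h2).resolve_left (pow_ne_zero _ (pow_ne_zero _ hp0)))
  obtain ⟨A, A', B, B', a, hA, hB, ha, hZ'⟩ := smith_int Z hZ
  let u : Fin n → ℤ_[p]ˣ := fun i => PadicInt.unitCoeff (ha i)
  let U : Matrix (Fin n) (Fin n) ℤ_[p] := Matrix.diagonal fun i => (u i : ℤ_[p])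
  let U' : Matrix (Fin n) (Fin n) ℤ_[p] := Matrix.diagonal fun i => ((u i)⁻¹ : ℤ_[p]ˣ)
  have hU : U * U' = 1 := by simp [U, U', Matrix.diagonal_mul_diagonal]
  let P : Matrix (Fin n) (Fin n) ℤ_[p] := Matrix.diagonal fun i => (p : ℤ_[p]) ^ (a i).valuation
  have hP : Matrix.diagonal a = P * U := by
    simp only [P, U, Matrix.diagonal_mul_diagonal]
    congr 1; ext1 i
    rw [mul_comm]
    exact PadicInt.unitCoeff_spec (ha i)
  refine ⟨A.map (algebraMap ℤ_[p] ℚ_[p]), 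
    fun i => (p : ℚ_[p]) ^ (-((N : ℤ) - ((a i).valuation : ℤ))),
    (U * B).map (algebraMap ℤ_[p] ℚ_[p]),
    ⟨isGLZp_of_padicInt _ _ hA, isGLZp_of_padicInt (U * B) (B' * U') ?_, fun j => Or.inr ⟨_, rfl⟩, ?_⟩,
    fun i => zpow_ne_zero _ hp0⟩
  · rw [Matrix.mul_assoc, ← Matrix.mul_assoc B, hB, Matrix.one_mul, hU]
  · have h1 : (p : ℚ_[p]) ^ N • z = A.map (algebraMap ℤ_[p] ℚ_[p]) * 
        P.map (algebraMap ℤ_[p] ℚ_[p]) * (U * B).map (algebraMap ℤ_[p] ℚ_[p]) := by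
      rw [← hZz, hZ', hP, ← Matrix.map_mul, ← Matrix.map_mul]
      simp only [Matrix.mul_assoc]
    have h2 : Matrix.diagonal (fun i => (p : ℚ_[p]) ^ (-((N : ℤ) - ((a i).valuation : ℤ)))) =
        ((p : ℚ_[p]) ^ N)⁻¹ • P.map (algebraMap ℤ_[p] ℚ_[p]) := by
      simp only [P]
      rw [Matrix.diagonal_map (map_zero _), ← Matrix.diagonal_smul]
      congr 1; ext1 i
      simp [neg_sub, zpow_sub₀ hp0, div_eq_inv_mul]
    rw [h2, Matrix.mul_smul, Matrix.smul_mul, ← h1, smul_smul, inv_mul_cancel₀ (pow_ne_zero _ hp0),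
      one_smul]

/-! ### Haar measure on the space of matrices -/

lemma haar_eq_smul {G : Type*} [TopologicalSpace G] [AddGroup G] [IsTopologicalAddGroup G]
    [MeasurableSpace G] [BorelSpace G] [LocallyCompactSpace G] [SecondCountableTopology G]
    (μ ν : Measure G) [μ.IsAddHaarMeasure] [ν.IsAddHaarMeasure] (K : Set G) (hK : ν K = 1) :
    μ = μ K • ν := by
  have h := Measure.isAddLeftInvariant_eq_smul μ ν
  have h2 : μ K = (μ.addHaarScalarFactor ν : ℝ≥0∞) := by
    conv_lhs => rw [h]
    simp [hK]
  rw [h2]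
  exact h

lemma vol_box {n : ℕ} (vol : Measure (Matrix (Fin n) (Fin n) ℚ_[p])) [vol.IsAddHaarMeasure]
    (hnorm : vol {z : Matrix (Fin n) (Fin n) ℚ_[p] | ∀ i j, ‖z i j‖ ≤ 1} = 1)
    (κ : Measure ℚ_[p]) [κ.IsAddHaarMeasure] (h1 : κ {x | ‖x‖ ≤ 1} = 1)
    (S : Fin n → Fin n → Set ℚ_[p]) :
    vol {z | ∀ i j, z i j ∈ S i j} = ∏ i, ∏ j, κ (S i j) := by
  let π : Measure (Fin n → Fin n → ℚ_[p]) := Measure.pi fun _ => Measure.pi fun _ => κ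
  have hbox : ∀ S : Fin n → Fin n → Set ℚ_[p],
      π {z | ∀ i j, z i j ∈ S i j} = ∏ i, ∏ j, κ (S i j) := by
    intro S
    have : {z : Fin n → Fin n → ℚ_[p] | ∀ i j, z i j ∈ S i j} =
        Set.univ.pi fun i => Set.univ.pi fun j => S i j := by
      ext z; simp [Set.mem_pi]
    rw [this, Measure.pi_pi]
    simp_rw [Measure.pi_pi]
  have hπ1 : (Measure.pi fun _ : Fin n => κ).IsAddHaarMeasure := inferInstance
  have hπ : π.IsAddHaarMeasure := Measure.pi.isAddHaarMeasure _
  let π' : Measure (Matrix (Fin n) (Fin n) ℚ_[p]) := π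
  have hπ' : π'.IsAddHaarMeasure := hπ
  have hone : π' {z : Matrix (Fin n) (Fin n) ℚ_[p] | ∀ i j, ‖z i j‖ ≤ 1} = 1 := by
    have := hbox (fun _ _ => {x | ‖x‖ ≤ 1})
    simp only [h1, Finset.prod_const_one] at this
    exact this
  have := haar_eq_smul vol π' _ hone
  rw [hnorm, one_smul] at this
  rw [this]
  exact hbox S

/-- The set of integral matrices. -/
def intSet (p : ℕ) [Fact p.Prime] (n : ℕ) : Set (Matrix (Fin n) (Fin n) ℚ_[p]) :=
  {z | ∀ i j, ‖z i j‖ ≤ 1}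

lemma measurableSet_intSet (n : ℕ) : MeasurableSet (intSet p n) := by
  have : intSet p n = ⋂ i, ⋂ j, {z | ‖z i j‖ ≤ 1} := by
    ext z; simp [intSet]
  rw [this]
  refine MeasurableSet.iInter fun i => MeasurableSet.iInter fun j => ?_
  exact (isClosed_le (by fun_prop) continuous_const).measurableSet

lemma map_vol_of_equiv {n : ℕ} (vol : Measure (Matrix (Fin n) (Fin n) ℚ_[p]))
    [vol.IsAddHaarMeasure] (hnorm : vol (intSet p n) = 1)
    (f g : Matrix (Fin n) (Fin n) ℚ_[p] → Matrix (Fin n) (Fin n) ℚ_[p])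
    (hf : Continuous f) (hg : Continuous g) (hadd : ∀ x y, f (x + y) = f x + f y)
    (hfg : ∀ x, f (g x) = x) (hgf : ∀ x, g (f x) = x) :
    Measure.map f vol = vol (f ⁻¹' intSet p n) • vol := by
  let e : Matrix (Fin n) (Fin n) ℚ_[p] ≃+ Matrix (Fin n) (Fin n) ℚ_[p] :=
    { toFun := f, invFun := g, left_inv := hgf, right_inv := hfg, map_add' := hadd }
  have : (Measure.map f vol).IsAddHaarMeasure := e.isAddHaarMeasure_map vol hf hg
  have h := haar_eq_smul (Measure.map f vol) vol _ hnorm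
  rwa [Measure.map_apply hf.measurable (measurableSet_intSet n)] at h

lemma intSet_mul {n : ℕ} {A B : Matrix (Fin n) (Fin n) ℚ_[p]} (hA : A ∈ intSet p n)
    (hB : B ∈ intSet p n) : A * B ∈ intSet p n := by
  intro i j
  rw [Matrix.mul_apply]
  refine IsUltrametricDist.norm_sum_le_of_forall_le_of_nonneg zero_le_one fun k _ => ?_
  rw [norm_mul]
  exact mul_le_one₀ (hA i k) (norm_nonneg _) (hB k j)

lemma intSet_mul_left_iff {n : ℕ} {A : Matrix (Fin n) (Fin n) ℚ_[p]} (hA : IsGLZp A)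
    (z : Matrix (Fin n) (Fin n) ℚ_[p]) : A * z ∈ intSet p n ↔ z ∈ intSet p n := by
  obtain ⟨h1, B, h2, h3, h4⟩ := hA
  refine ⟨fun h => ?_, fun h => intSet_mul h1 h⟩
  have := intSet_mul (A := B) h2 h
  rwa [← Matrix.mul_assoc, h4, Matrix.one_mul] at this

lemma intSet_mul_right_iff {n : ℕ} {A : Matrix (Fin n) (Fin n) ℚ_[p]} (hA : IsGLZp A)
    (z : Matrix (Fin n) (Fin n) ℚ_[p]) : z * A ∈ intSet p n ↔ z ∈ intSet p n := by
  obtain ⟨h1, B, h2, h3, h4⟩ := hA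
  refine ⟨fun h => ?_, fun h => intSet_mul h h1⟩
  have := intSet_mul (B := B) h h2
  rwa [Matrix.mul_assoc, h3, Matrix.mul_one] at this

lemma map_left_GLZp {n : ℕ} (vol : Measure (Matrix (Fin n) (Fin n) ℚ_[p]))
    [vol.IsAddHaarMeasure] (hnorm : vol (intSet p n) = 1)
    {A : Matrix (Fin n) (Fin n) ℚ_[p]} (hA : IsGLZp A) :
    Measure.map (fun z => A * z) vol = vol := by
  obtain ⟨h1, B, h2, h3, h4⟩ := id hA
  rw [map_vol_of_equiv vol hnorm (fun z => A * z) (fun z => B * z) (by fun_prop) (by fun_prop)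
    (fun x y => Matrix.mul_add _ _ _) (fun x => by simp [← Matrix.mul_assoc, h3])
    (fun x => by simp [← Matrix.mul_assoc, h4])]
  have : (fun z => A * z) ⁻¹' intSet p n = intSet p n := by
    ext z; exact intSet_mul_left_iff hA z
  rw [this, hnorm, one_smul]

lemma map_right_GLZp {n : ℕ} (vol : Measure (Matrix (Fin n) (Fin n) ℚ_[p]))
    [vol.IsAddHaarMeasure] (hnorm : vol (intSet p n) = 1)
    {A : Matrix (Fin n) (Fin n) ℚ_[p]} (hA : IsGLZp A) :
    Measure.map (fun z => z * A) vol = vol := by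
  obtain ⟨h1, B, h2, h3, h4⟩ := id hA
  rw [map_vol_of_equiv vol hnorm (fun z => z * A) (fun z => z * B) (by fun_prop) (by fun_prop)
    (fun x y => Matrix.add_mul _ _ _) (fun x => by simp [Matrix.mul_assoc, h4])
    (fun x => by simp [Matrix.mul_assoc, h3])]
  have : (fun z => z * A) ⁻¹' intSet p n = intSet p n := by
    ext z; exact intSet_mul_right_iff hA z
  rw [this, hnorm, one_smul]

lemma diag_inv {n : ℕ} {d : Fin n → ℚ_[p]} (hd : ∀ i, d i ≠ 0) :
    Matrix.diagonal d * Matrix.diagonal (fun i => (d i)⁻¹) = 1 ∧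
    Matrix.diagonal (fun i => (d i)⁻¹) * Matrix.diagonal d = 1 := by
  simp [Matrix.diagonal_mul_diagonal, hd]

lemma ofReal_prod_inv {n : ℕ} (d : Fin n → ℚ_[p]) :
    ∏ i, (ENNReal.ofReal ‖d i‖⁻¹) ^ n = ENNReal.ofReal ((‖(Matrix.diagonal d).det‖ ^ n)⁻¹) := by
  rw [Matrix.det_diagonal, norm_prod, Finset.prod_pow, ← ENNReal.ofReal_prod_of_nonneg
    (fun _ _ => by positivity), ← ENNReal.ofReal_pow (Finset.prod_nonneg fun _ _ => by positivity),
    Finset.prod_inv_distrib, inv_pow]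

lemma map_left_diag {n : ℕ} (vol : Measure (Matrix (Fin n) (Fin n) ℚ_[p]))
    [vol.IsAddHaarMeasure] (hnorm : vol (intSet p n) = 1)
    {d : Fin n → ℚ_[p]} (hd : ∀ i, d i ≠ 0) :
    Measure.map (fun z => Matrix.diagonal d * z) vol =
      ENNReal.ofReal ((‖(Matrix.diagonal d).det‖ ^ n)⁻¹) • vol := by
  obtain ⟨h3, h4⟩ := diag_inv hd
  obtain ⟨κ, hκ, hκ1⟩ := exists_kappa (p := p)
  rw [map_vol_of_equiv vol hnorm (fun z => Matrix.diagonal d * z)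
    (fun z => Matrix.diagonal (fun i => (d i)⁻¹) * z) (by fun_prop) (by fun_prop)
    (fun x y => Matrix.mul_add _ _ _) (fun x => by rw [← Matrix.mul_assoc, h3, Matrix.one_mul])
    (fun x => by rw [← Matrix.mul_assoc, h4, Matrix.one_mul])]
  have : (fun z => Matrix.diagonal d * z) ⁻¹' intSet p n =
      {z | ∀ i j, z i j ∈ (fun i _ => {x | ‖d i * x‖ ≤ 1} : Fin n → Fin n → Set ℚ_[p]) i j} := by
    ext z; simp [intSet, Matrix.diagonal_mul]
  rw [this, vol_box vol hnorm κ hκ1, ← ofReal_prod_inv]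
  simp only [ball_vol_norm κ hκ1 _ (hd _), Finset.prod_const, Finset.card_univ, Fintype.card_fin]

lemma map_right_diag {n : ℕ} (vol : Measure (Matrix (Fin n) (Fin n) ℚ_[p]))
    [vol.IsAddHaarMeasure] (hnorm : vol (intSet p n) = 1)
    {d : Fin n → ℚ_[p]} (hd : ∀ i, d i ≠ 0) :
    Measure.map (fun z => z * Matrix.diagonal d) vol =
      ENNReal.ofReal ((‖(Matrix.diagonal d).det‖ ^ n)⁻¹) • vol := by
  obtain ⟨h3, h4⟩ := diag_inv hd
  obtain ⟨κ, hκ, hκ1⟩ := exists_kappa (p := p)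
  rw [map_vol_of_equiv vol hnorm (fun z => z * Matrix.diagonal d)
    (fun z => z * Matrix.diagonal (fun i => (d i)⁻¹)) (by fun_prop) (by fun_prop)
    (fun x y => Matrix.add_mul _ _ _) (fun x => by rw [Matrix.mul_assoc, h4, Matrix.mul_one])
    (fun x => by rw [Matrix.mul_assoc, h3, Matrix.mul_one])]
  have : (fun z => z * Matrix.diagonal d) ⁻¹' intSet p n =
      {z | ∀ i j, z i j ∈ (fun _ j => {x | ‖d j * x‖ ≤ 1} : Fin n → Fin n → Set ℚ_[p]) i j} := by
    ext z; simp [intSet, Matrix.mul_diagonal, mul_comm]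
  rw [this, vol_box vol hnorm κ hκ1, ← ofReal_prod_inv, Finset.prod_comm]
  simp only [ball_vol_norm κ hκ1 _ (hd _), Finset.prod_const, Finset.card_univ, Fintype.card_fin]

lemma norm_det_le_one {n : ℕ} {A : Matrix (Fin n) (Fin n) ℚ_[p]} (hA : A ∈ intSet p n) :
    ‖A.det‖ ≤ 1 := by
  let Z : Matrix (Fin n) (Fin n) ℤ_[p] := fun i j => ⟨_, hA i j⟩
  have h : A = Z.map (algebraMap ℤ_[p] ℚ_[p]) := by ext i j; rfl
  have := (algebraMap ℤ_[p] ℚ_[p]).map_det Z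
  rw [h]
  have h2 : ‖algebraMap ℤ_[p] ℚ_[p] Z.det‖ ≤ 1 := Z.det.norm_le_one
  rw [this] at h2
  exact h2

lemma IsGLZp.norm_det {n : ℕ} {A : Matrix (Fin n) (Fin n) ℚ_[p]} (hA : IsGLZp A) :
    ‖A.det‖ = 1 := by
  obtain ⟨h1, B, h2, h3, h4⟩ := hA
  have a1 := norm_det_le_one h1
  have a2 := norm_det_le_one h2
  have h5 : ‖A.det‖ * ‖B.det‖ = 1 := by rw [← norm_mul, ← Matrix.det_mul, h3]; simp
  nlinarith [norm_nonneg A.det, norm_nonneg B.det]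

lemma map_left {n : ℕ} (vol : Measure (Matrix (Fin n) (Fin n) ℚ_[p]))
    [vol.IsAddHaarMeasure] (hnorm : vol (intSet p n) = 1)
    {g : Matrix (Fin n) (Fin n) ℚ_[p]} (hg : g.det ≠ 0) :
    Measure.map (fun z => g * z) vol = ENNReal.ofReal ((‖g.det‖ ^ n)⁻¹) • vol := by
  obtain ⟨A, d, B, ⟨hA, hB, -, rfl⟩, hd⟩ := exists_smith g hg
  have h : (fun z => A * Matrix.diagonal d * B * z) =
      (fun z => A * z) ∘ (fun z => Matrix.diagonal d * z) ∘ (fun z => B * z) := by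
    ext1 z; simp [Matrix.mul_assoc]
  rw [h, ← Measure.map_map (by fun_prop) (by fun_prop), ← Measure.map_map (by fun_prop) (by fun_prop),
    map_left_GLZp vol hnorm hB, map_left_diag vol hnorm hd, Measure.map_smul,
    map_left_GLZp vol hnorm hA, Matrix.det_mul, Matrix.det_mul, norm_mul, norm_mul, hA.norm_det,
    hB.norm_det, one_mul, mul_one]

lemma map_right {n : ℕ} (vol : Measure (Matrix (Fin n) (Fin n) ℚ_[p]))
    [vol.IsAddHaarMeasure] (hnorm : vol (intSet p n) = 1)
    {g : Matrix (Fin n) (Fin n) ℚ_[p]} (hg : g.det ≠ 0) :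
    Measure.map (fun z => z * g) vol = ENNReal.ofReal ((‖g.det‖ ^ n)⁻¹) • vol := by
  obtain ⟨A, d, B, ⟨hA, hB, -, rfl⟩, hd⟩ := exists_smith g hg
  have h : (fun z => z * (A * Matrix.diagonal d * B)) =
      (fun z => z * B) ∘ (fun z => z * Matrix.diagonal d) ∘ (fun z => z * A) := by
    ext1 z; simp [Matrix.mul_assoc]
  rw [h, ← Measure.map_map (by fun_prop) (by fun_prop), ← Measure.map_map (by fun_prop) (by fun_prop),
    map_right_GLZp vol hnorm hA, map_right_diag vol hnorm hd, Measure.map_smul,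
    map_right_GLZp vol hnorm hB, Matrix.det_mul, Matrix.det_mul, norm_mul, norm_mul, hA.norm_det,
    hB.norm_det, one_mul, mul_one]

/-! ### The function `γ` -/

/-- The volume of the integral `x` such that `z * x` is integral; it equals `γ(z)^{-n}`. -/
noncomputable def volFn {n : ℕ} (vol : Measure (Matrix (Fin n) (Fin n) ℚ_[p]))
    (z : Matrix (Fin n) (Fin n) ℚ_[p]) : ℝ≥0∞ :=
  vol {x | x ∈ intSet p n ∧ z * x ∈ intSet p n}

lemma measurable_volFn {n : ℕ} (vol : Measure (Matrix (Fin n) (Fin n) ℚ_[p]))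
    [vol.IsAddHaarMeasure] : Measurable (volFn vol) := by
  have hs : MeasurableSet {q : Matrix (Fin n) (Fin n) ℚ_[p] × Matrix (Fin n) (Fin n) ℚ_[p] |
      q.2 ∈ intSet p n ∧ q.1 * q.2 ∈ intSet p n} := by
    refine MeasurableSet.inter ?_ ?_
    · exact (measurableSet_intSet n).preimage measurable_snd
    · have : Continuous (fun q : Matrix (Fin n) (Fin n) ℚ_[p] × Matrix (Fin n) (Fin n) ℚ_[p] =>
        q.1 * q.2) := by fun_prop
      exact (measurableSet_intSet n).preimage this.measurable
  exact measurable_measure_prodMk_left (ν := vol) hs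

lemma volFn_smith {n : ℕ} (vol : Measure (Matrix (Fin n) (Fin n) ℚ_[p]))
    [vol.IsAddHaarMeasure] (hnorm : vol (intSet p n) = 1)
    {z A B : Matrix (Fin n) (Fin n) ℚ_[p]} {d : Fin n → ℚ_[p]} (h : IsSmith z A d B) :
    volFn vol z = ENNReal.ofReal (((∏ j, max ‖d j‖ 1) ^ n)⁻¹) := by
  obtain ⟨hA, hB, -, rfl⟩ := h
  obtain ⟨κ, hκ, hκ1⟩ := exists_kappa (p := p)
  have h1 : {x | x ∈ intSet p n ∧ A * Matrix.diagonal d * B * x ∈ intSet p n} =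
      (fun x => B * x) ⁻¹' {x | x ∈ intSet p n ∧ Matrix.diagonal d * x ∈ intSet p n} := by
    ext x
    simp only [Set.mem_ofPred_eq, Set.mem_preimage, intSet_mul_left_iff hB, Matrix.mul_assoc,
      intSet_mul_left_iff hA]
  have h2 : MeasurableSet {x | x ∈ intSet p n ∧ Matrix.diagonal d * x ∈ intSet p n} :=
    (measurableSet_intSet n).inter
      ((measurableSet_intSet n).preimage (f := fun x => Matrix.diagonal d * x) (by fun_prop))
  rw [volFn, h1, ← Measure.map_apply (by fun_prop) h2, map_left_GLZp vol hnorm hB]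
  have h3 : {x | x ∈ intSet p n ∧ Matrix.diagonal d * x ∈ intSet p n} =
      {z | ∀ i j, z i j ∈
        (fun i _ => {x | ‖x‖ ≤ 1 ∧ ‖d i * x‖ ≤ 1} : Fin n → Fin n → Set ℚ_[p]) i j} := by
    ext z; simp [intSet, Matrix.diagonal_mul, forall_and]
  rw [h3, vol_box vol hnorm κ hκ1]
  simp only [ball_vol_max κ hκ1, Finset.prod_const, Finset.card_univ, Fintype.card_fin]
  rw [Finset.prod_pow, ← ENNReal.ofReal_prod_of_nonneg
    (fun _ _ => by positivity), ← ENNReal.ofReal_pow (Finset.prod_nonneg fun _ _ => by positivity),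
    Finset.prod_inv_distrib, inv_pow]

lemma gammaFn_eq {n : ℕ} (vol : Measure (Matrix (Fin n) (Fin n) ℚ_[p]))
    [vol.IsAddHaarMeasure] (hnorm : vol (intSet p n) = 1)
    {z A B : Matrix (Fin n) (Fin n) ℚ_[p]} {d : Fin n → ℚ_[p]} (h : IsSmith z A d B) :
    gammaFn z = ∏ j, max ‖d j‖ 1 := by
  have hex : ∃ A d B, IsSmith z A d B := ⟨A, d, B, h⟩
  rw [gammaFn, dif_pos hex]
  obtain ⟨B', hs⟩ := hex.choose_spec.choose_spec
  rcases Nat.eq_zero_or_pos n with rfl | hn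
  · simp
  have e := (volFn_smith vol hnorm hs).symm.trans (volFn_smith vol hnorm h)
  have pos : ∀ d : Fin n → ℚ_[p], 0 < ∏ j, max ‖d j‖ 1 :=
    fun d => Finset.prod_pos fun j _ => lt_max_of_lt_right one_pos
  rw [ENNReal.ofReal_eq_ofReal_iff (by have := pos hex.choose_spec.choose; positivity)
    (by have := pos d; positivity), _root_.inv_inj] at e
  exact (pow_left_inj₀ (pos _).le (pos _).le hn.ne').1 e

/-- `γ` recovered from `volFn`. -/
noncomputable def gammaM {n : ℕ} (vol : Measure (Matrix (Fin n) (Fin n) ℚ_[p]))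
    (z : Matrix (Fin n) (Fin n) ℚ_[p]) : ℝ :=
  ((volFn vol z).toReal)⁻¹ ^ ((n : ℝ)⁻¹)

lemma measurable_gammaM {n : ℕ} (vol : Measure (Matrix (Fin n) (Fin n) ℚ_[p]))
    [vol.IsAddHaarMeasure] : Measurable (gammaM vol) := by
  have := measurable_volFn vol
  unfold gammaM
  fun_prop

lemma gammaM_eq {n : ℕ} (vol : Measure (Matrix (Fin n) (Fin n) ℚ_[p]))
    [vol.IsAddHaarMeasure] (hnorm : vol (intSet p n) = 1)
    {z : Matrix (Fin n) (Fin n) ℚ_[p]} (hz : z.det ≠ 0) : gammaM vol z = gammaFn z := by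
  obtain ⟨A, d, B, h, -⟩ := exists_smith z hz
  have pos : 0 < ∏ j, max ‖d j‖ 1 :=
    Finset.prod_pos fun j _ => lt_max_of_lt_right one_pos
  rw [gammaFn_eq vol hnorm h, gammaM, volFn_smith vol hnorm h, ENNReal.toReal_ofReal (by positivity),
    inv_inv]
  rcases Nat.eq_zero_or_pos n with rfl | hn
  · simp
  exact Real.pow_rpow_inv_natCast pos.le hn.ne'

lemma IsGLZp.inv {n : ℕ} {A : Matrix (Fin n) (Fin n) ℚ_[p]} (hA : IsGLZp A) : IsGLZp A⁻¹ := by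
  obtain ⟨h1, B, h2, h3, h4⟩ := hA
  rw [Matrix.inv_eq_right_inv h3]
  exact ⟨h2, A, h1, h4, h3⟩

lemma gammaFn_pos {n : ℕ} (z : Matrix (Fin n) (Fin n) ℚ_[p]) : 0 < gammaFn z := by
  unfold gammaFn
  split_ifs
  · exact Finset.prod_pos fun j _ => lt_max_of_lt_right one_pos
  · exact one_pos

lemma gammaFn_inv {n : ℕ} (vol : Measure (Matrix (Fin n) (Fin n) ℚ_[p]))
    [vol.IsAddHaarMeasure] (hnorm : vol (intSet p n) = 1)
    {z : Matrix (Fin n) (Fin n) ℚ_[p]} (hz : z.det ≠ 0) :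
    gammaFn z⁻¹ = gammaFn z / ‖z.det‖ := by
  obtain ⟨A, d, B, h, hd⟩ := exists_smith z hz
  obtain ⟨hA, hB, hk, hz'⟩ := id h
  have hi : IsSmith z⁻¹ B⁻¹ (fun i => (d i)⁻¹) A⁻¹ := by
    refine ⟨hB.inv, hA.inv, fun j => Or.inr ?_, ?_⟩
    · obtain ⟨k, hk⟩ := (hk j).resolve_left (hd j)
      refine ⟨-k, ?_⟩
      simp only [hk, ← _root_.zpow_neg]
    · rw [hz', Matrix.mul_inv_rev, Matrix.mul_inv_rev, Matrix.inv_eq_right_inv (diag_inv hd).1,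
        Matrix.mul_assoc]
  rw [gammaFn_eq vol hnorm h, gammaFn_eq vol hnorm hi, hz', Matrix.det_mul, Matrix.det_mul, norm_mul,
    norm_mul, hA.norm_det, hB.norm_det, Matrix.det_diagonal, one_mul, mul_one, norm_prod,
    ← Finset.prod_div_distrib]
  refine Finset.prod_congr rfl fun i _ => ?_
  have hp : 0 < ‖d i‖ := norm_pos_iff.2 (hd i)
  rw [norm_inv]
  rcases le_total ‖d i‖ 1 with h | h
  · rw [max_eq_right h, max_eq_left ((one_le_inv₀ hp).2 h), one_div]
  · rw [max_eq_left h, max_eq_right (inv_le_one_of_one_le₀ h), div_self hp.ne']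

/-! ### Singular matrices form a null set -/

lemma vol_singular {n : ℕ} (vol : Measure (Matrix (Fin n) (Fin n) ℚ_[p]))
    [vol.IsAddHaarMeasure] : vol {z | z.det = 0} = 0 := by
  classical
  obtain ⟨κ, hκ, -⟩ := exists_kappa (p := p)
  let T : Set (Matrix (Fin n) (Fin n) ℚ_[p] × ℚ_[p]) :=
    {q | (q.1 + Matrix.scalar (Fin n) q.2).det = 0}
  have hcont : Continuous fun q : Matrix (Fin n) (Fin n) ℚ_[p] × ℚ_[p] =>
      (q.1 + Matrix.scalar (Fin n) q.2).det := by
    simp only [Matrix.scalar_apply]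
    fun_prop
  have hT : MeasurableSet T := (isClosed_eq hcont continuous_const).measurableSet
  have h0 : (vol.prod κ) T = 0 := by
    rw [Measure.measure_prod_null hT]
    refine Filter.Eventually.of_forall fun z => ?_
    have : (Prod.mk z ⁻¹' T) ⊆ (((-z).charpoly.roots.toFinset : Finset ℚ_[p]) : Set ℚ_[p]) := by
      intro t ht
      have ht' : (z + Matrix.scalar (Fin n) t).det = 0 := ht
      simp only [Finset.mem_coe, Multiset.mem_toFinset]
      rw [Polynomial.mem_roots (Matrix.charpoly_monic _).ne_zero, Polynomial.IsRoot,
        Matrix.eval_charpoly, sub_neg_eq_add, add_comm]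
      exact ht'
    exact measure_mono_null this ((Finset.finite_toSet _).measure_zero κ)
  have h1 : (κ.prod vol) (Prod.swap ⁻¹' T) = 0 := by
    rw [← Measure.prod_swap, Measure.map_apply measurable_swap hT] at h0
    exact h0
  rw [Measure.measure_prod_null (hT.preimage measurable_swap)] at h1
  obtain ⟨t, ht⟩ := h1.exists
  have h2 : Prod.mk t ⁻¹' (Prod.swap ⁻¹' T) =
      (fun z => z + Matrix.scalar (Fin n) t) ⁻¹' {z : Matrix (Fin n) (Fin n) ℚ_[p] | z.det = 0} := by
    ext z; rfl
  simp only [h2, measure_preimage_add_right] at ht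
  exact ht

lemma ae_det_ne {n : ℕ} (vol : Measure (Matrix (Fin n) (Fin n) ℚ_[p]))
    [vol.IsAddHaarMeasure] : ∀ᵐ z ∂vol, z.det ≠ 0 := by
  rw [ae_iff]
  simpa using vol_singular vol

/-! ### The Haar measure of `GL(n, ℚ_p)` and its invariance under inversion -/

/-- Density of the multiplicative Haar measure. -/
noncomputable def wFn {n : ℕ} (z : Matrix (Fin n) (Fin n) ℚ_[p]) : ℝ≥0∞ :=
  ENNReal.ofReal ((‖z.det‖ ^ n)⁻¹)

lemma measurable_wFn {n : ℕ} : Measurable (wFn : Matrix (Fin n) (Fin n) ℚ_[p] → ℝ≥0∞) := by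
  unfold wFn
  have : Measurable fun z : Matrix (Fin n) (Fin n) ℚ_[p] => ‖z.det‖ :=
    (by fun_prop : Continuous fun z : Matrix (Fin n) (Fin n) ℚ_[p] => ‖z.det‖).measurable
  fun_prop

lemma wFn_mul {n : ℕ} (x y : Matrix (Fin n) (Fin n) ℚ_[p]) : wFn (x * y) = wFn x * wFn y := by
  unfold wFn
  rw [← ENNReal.ofReal_mul (by positivity), Matrix.det_mul, norm_mul, mul_pow, mul_inv]

lemma wFn_ne_zero {n : ℕ} {x : Matrix (Fin n) (Fin n) ℚ_[p]} (hx : x.det ≠ 0) : wFn x ≠ 0 := by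
  have : 0 < ‖x.det‖ := norm_pos_iff.2 hx
  unfold wFn
  simp only [ne_eq, ENNReal.ofReal_eq_zero, not_le]
  positivity

/-- The multiplicative Haar measure. -/
noncomputable def nuM {n : ℕ} (vol : Measure (Matrix (Fin n) (Fin n) ℚ_[p])) :
    Measure (Matrix (Fin n) (Fin n) ℚ_[p]) := vol.withDensity wFn

lemma lintegral_nuM {n : ℕ} (vol : Measure (Matrix (Fin n) (Fin n) ℚ_[p]))
    {F : Matrix (Fin n) (Fin n) ℚ_[p] → ℝ≥0∞} (hF : Measurable F) :
    ∫⁻ z, F z ∂(nuM vol) = ∫⁻ z, wFn z * F z ∂vol :=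
  lintegral_withDensity_eq_lintegral_mul vol measurable_wFn hF

lemma nuM_left {n : ℕ} (vol : Measure (Matrix (Fin n) (Fin n) ℚ_[p]))
    [vol.IsAddHaarMeasure] (hnorm : vol (intSet p n) = 1)
    {g : Matrix (Fin n) (Fin n) ℚ_[p]} (hg : g.det ≠ 0)
    {F : Matrix (Fin n) (Fin n) ℚ_[p] → ℝ≥0∞} (hF : Measurable F) :
    ∫⁻ z, F (g * z) ∂(nuM vol) = ∫⁻ z, F z ∂(nuM vol) := by
  have hm : Measurable fun z : Matrix (Fin n) (Fin n) ℚ_[p] => g * z := by fun_prop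
  have hm3 : Measurable fun z => F (g * z) := hF.comp hm
  have h1 := lintegral_map (μ := vol) (measurable_wFn.mul hF) hm
  rw [map_left vol hnorm hg, lintegral_smul_measure] at h1
  simp only [Pi.mul_apply, wFn_mul, mul_assoc] at h1
  have hm2 : Measurable fun z => wFn z * F (g * z) := measurable_wFn.mul (hF.comp hm)
  rw [lintegral_const_mul _ hm2] at h1
  rw [lintegral_nuM vol hF, lintegral_nuM vol hm3]
  exact ((ENNReal.mul_right_inj (wFn_ne_zero hg) ENNReal.ofReal_ne_top).1 h1).symm

lemma nuM_right {n : ℕ} (vol : Measure (Matrix (Fin n) (Fin n) ℚ_[p]))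
    [vol.IsAddHaarMeasure] (hnorm : vol (intSet p n) = 1)
    {g : Matrix (Fin n) (Fin n) ℚ_[p]} (hg : g.det ≠ 0)
    {F : Matrix (Fin n) (Fin n) ℚ_[p] → ℝ≥0∞} (hF : Measurable F) :
    ∫⁻ z, F (z * g) ∂(nuM vol) = ∫⁻ z, F z ∂(nuM vol) := by
  have hm : Measurable fun z : Matrix (Fin n) (Fin n) ℚ_[p] => z * g := by fun_prop
  have hm3 : Measurable fun z => F (z * g) := hF.comp hm
  have h1 := lintegral_map (μ := vol) (measurable_wFn.mul hF) hm
  rw [map_right vol hnorm hg, lintegral_smul_measure] at h1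
  simp only [Pi.mul_apply, wFn_mul, mul_comm _ (wFn g), mul_assoc] at h1
  have hm2 : Measurable fun z => wFn z * F (z * g) := measurable_wFn.mul (hF.comp hm)
  rw [lintegral_const_mul _ hm2] at h1
  rw [lintegral_nuM vol hF, lintegral_nuM vol hm3]
  exact ((ENNReal.mul_right_inj (wFn_ne_zero hg) ENNReal.ofReal_ne_top).1 h1).symm

lemma measurable_matInv {n : ℕ} :
    Measurable fun z : Matrix (Fin n) (Fin n) ℚ_[p] => z⁻¹ := by
  have h : (fun z : Matrix (Fin n) (Fin n) ℚ_[p] => z⁻¹) =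
      (fun q : ℚ_[p] × Matrix (Fin n) (Fin n) ℚ_[p] => q.1 • q.2) ∘
        fun z => ((z.det)⁻¹, z.adjugate) := by
    ext1 z
    simp [Matrix.inv_def]
  rw [h]
  have h1 : Measurable fun z : Matrix (Fin n) (Fin n) ℚ_[p] => z.det :=
    (by fun_prop : Continuous fun z : Matrix (Fin n) (Fin n) ℚ_[p] => z.det).measurable
  have h2 : Measurable fun z : Matrix (Fin n) (Fin n) ℚ_[p] => z.adjugate :=
    (continuous_id.matrix_adjugate).measurable
  have h3 : Continuous (fun q : ℚ_[p] × Matrix (Fin n) (Fin n) ℚ_[p] => q.1 • q.2) := by fun_prop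
  exact h3.measurable.comp (h1.inv.prodMk h2)

lemma exists_set {n : ℕ} (vol : Measure (Matrix (Fin n) (Fin n) ℚ_[p]))
    [vol.IsAddHaarMeasure] (hnorm : vol (intSet p n) = 1) :
    ∃ U : Set (Matrix (Fin n) (Fin n) ℚ_[p]), MeasurableSet U ∧ nuM vol U ≠ 0 ∧ nuM vol U ≠ ∞ := by
  let U : Set (Matrix (Fin n) (Fin n) ℚ_[p]) := intSet p n ∩ {z | 1 / 2 < ‖z.det‖}
  have hO : IsOpen {z : Matrix (Fin n) (Fin n) ℚ_[p] | 1 / 2 < ‖z.det‖} :=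
    isOpen_lt continuous_const (by fun_prop)
  have hU : MeasurableSet U := (measurableSet_intSet n).inter hO.measurableSet
  refine ⟨U, hU, ?_, ?_⟩
  · intro h
    rw [nuM, withDensity_apply_eq_zero measurable_wFn] at h
    have hsub : U ⊆ {x | wFn x ≠ 0} ∩ U := by
      intro z hz
      refine ⟨wFn_ne_zero ?_, hz⟩
      have : 1 / 2 < ‖z.det‖ := hz.2
      rw [← norm_pos_iff]; linarith
    have h0 : vol U = 0 := measure_mono_null hsub h
    have hnhds : U ∈ nhds (1 : Matrix (Fin n) (Fin n) ℚ_[p]) := by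
      refine Filter.inter_mem ?_ (hO.mem_nhds (by simp; norm_num))
      have : intSet p n = ⋂ i, ⋂ j, {z | ‖z i j‖ ≤ 1} := by
        ext z; simp [intSet]
      rw [this]
      refine Filter.iInter_mem.2 fun i => Filter.iInter_mem.2 fun j => ?_
      have h1 : IsOpen (Metric.closedBall (0 : ℚ_[p]) 1) :=
        IsUltrametricDist.isOpen_closedBall _ one_ne_zero
      have h2 : Continuous fun z : Matrix (Fin n) (Fin n) ℚ_[p] => z i j := by fun_prop
      have h3 := (h1.preimage h2).mem_nhds (x := 1) (by
        simp only [Set.mem_preimage, mem_closedBall_zero_iff, Matrix.one_apply]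
        split_ifs <;> simp)
      convert h3 using 1
      ext z; simp
    exact (Measure.measure_pos_of_mem_nhds vol hnhds).ne' h0
  · rw [nuM, withDensity_apply _ hU]
    have h1 : ∫⁻ z in U, wFn z ∂vol ≤ ∫⁻ z in U, ENNReal.ofReal (2 ^ n) ∂vol := by
      refine setLIntegral_mono measurable_const fun z hz => ?_
      have : 1 / 2 < ‖z.det‖ := hz.2
      unfold wFn
      apply ENNReal.ofReal_le_ofReal
      rw [← inv_pow]
      gcongr
      rw [inv_le_comm₀ (by linarith) (by norm_num)]
      linarith
    refine (lt_of_le_of_lt h1 ?_).ne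
    rw [setLIntegral_const]
    refine ENNReal.mul_lt_top ENNReal.ofReal_lt_top ?_
    refine lt_of_le_of_lt (measure_mono Set.inter_subset_left) ?_
    rw [hnorm]; exact ENNReal.one_lt_top

lemma nuM_inv {n : ℕ} (vol : Measure (Matrix (Fin n) (Fin n) ℚ_[p]))
    [vol.IsAddHaarMeasure] (hnorm : vol (intSet p n) = 1)
    {F : Matrix (Fin n) (Fin n) ℚ_[p] → ℝ≥0∞} (hF : Measurable F) :
    ∫⁻ z, F z⁻¹ ∂(nuM vol) = ∫⁻ z, F z ∂(nuM vol) := by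
  obtain ⟨U, hU, hU0, hUt⟩ := exists_set vol hnorm
  have : SFinite (nuM vol) := by unfold nuM; infer_instance
  set ν := nuM vol with hν
  have hae : ∀ᵐ z ∂ν, z.det ≠ 0 :=
    (withDensity_absolutelyContinuous vol wFn).ae_le (ae_det_ne vol)
  let G : Matrix (Fin n) (Fin n) ℚ_[p] → ℝ≥0∞ := U.indicator 1
  have hG : Measurable G := measurable_one.indicator hU
  have hGi : ∫⁻ z, G z ∂ν = ν U := lintegral_indicator_one hU
  have hmul : Measurable fun q : Matrix (Fin n) (Fin n) ℚ_[p] × Matrix (Fin n) (Fin n) ℚ_[p] =>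
      q.1 * q.2 := by
    have : Continuous fun q : Matrix (Fin n) (Fin n) ℚ_[p] × Matrix (Fin n) (Fin n) ℚ_[p] =>
      q.1 * q.2 := by fun_prop
    exact this.measurable
  have hFi : Measurable fun z : Matrix (Fin n) (Fin n) ℚ_[p] => F z⁻¹ := hF.comp measurable_matInv
  have key : (∫⁻ z, F z⁻¹ ∂ν) * ν U = (∫⁻ z, F z ∂ν) * ν U := by
    calc (∫⁻ z, F z⁻¹ ∂ν) * ν U = ∫⁻ x, F x⁻¹ * ∫⁻ y, G y ∂ν ∂ν := by
          rw [hGi, lintegral_mul_const _ hFi]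
      _ = ∫⁻ x, ∫⁻ y, F x⁻¹ * G (y * x) ∂ν ∂ν := by
          refine lintegral_congr_ae ?_
          filter_upwards [hae] with x hx
          have hm : Measurable fun y : Matrix (Fin n) (Fin n) ℚ_[p] => G (y * x) :=
            hG.comp (by fun_prop)
          rw [lintegral_const_mul _ hm, nuM_right vol hnorm hx hG]
      _ = ∫⁻ y, ∫⁻ x, F x⁻¹ * G (y * x) ∂ν ∂ν := by
          refine lintegral_lintegral_swap (Measurable.aemeasurable ?_)
          exact (hFi.comp measurable_fst).mul (hG.comp (hmul.comp measurable_swap))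
      _ = ∫⁻ y, ∫⁻ x, F (x⁻¹ * y) * G x ∂ν ∂ν := by
          refine lintegral_congr_ae ?_
          filter_upwards [hae] with y hy
          have hm : Measurable fun x : Matrix (Fin n) (Fin n) ℚ_[p] => F (x⁻¹ * y) * G x :=
            (hF.comp (hmul.comp (measurable_matInv.prodMk measurable_const))).mul hG
          rw [← nuM_left vol hnorm hy hm]
          refine lintegral_congr fun x => ?_
          rw [Matrix.mul_inv_rev, Matrix.mul_assoc,
            Matrix.nonsing_inv_mul _ (isUnit_iff_ne_zero.2 hy), Matrix.mul_one]
      _ = ∫⁻ x, ∫⁻ y, F (x⁻¹ * y) * G x ∂ν ∂ν := by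
          refine lintegral_lintegral_swap (Measurable.aemeasurable ?_)
          exact (hF.comp (hmul.comp ((measurable_matInv.comp measurable_snd).prodMk
            measurable_fst))).mul (hG.comp measurable_snd)
      _ = ∫⁻ x, (∫⁻ y, F y ∂ν) * G x ∂ν := by
          refine lintegral_congr_ae ?_
          filter_upwards [hae] with x hx
          have hx' : (x⁻¹).det ≠ 0 := by
            rw [Matrix.det_nonsing_inv, Ring.inverse_eq_inv']
            exact inv_ne_zero hx
          have hm : Measurable fun y : Matrix (Fin n) (Fin n) ℚ_[p] => F (x⁻¹ * y) :=
            hF.comp (by fun_prop)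
          rw [lintegral_mul_const _ hm, nuM_left vol hnorm hx' hF]
      _ = (∫⁻ z, F z ∂ν) * ν U := by rw [lintegral_const_mul _ hG, hGi]
  exact (ENNReal.mul_left_inj hU0 hUt).1 key

/-- the pushforward of `μ_s^n` under `z ↦ z⁻¹` has density
`|det z|_p^s` with respect to `μ_s^n`. -/
theorem map_inv_huaMeasure (n : ℕ)
    (vol : Measure (Matrix (Fin n) (Fin n) ℚ_[p])) [vol.IsAddHaarMeasure]
    (hnorm : vol {z : Matrix (Fin n) (Fin n) ℚ_[p] | ∀ i j, ‖z i j‖ ≤ 1} = 1)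
    (s : ℝ) (hs : -1 < s) :
    Measure.map (fun z : Matrix (Fin n) (Fin n) ℚ_[p] => z⁻¹) (huaMeasure p n s vol) =
      (huaMeasure p n s vol).withDensity
        (fun z => ENNReal.ofReal (‖z.det‖ ^ s)) := by
  have hnorm' : vol (intSet p n) = 1 := hnorm
  have hae := ae_det_ne vol
  -- a measurable version of the density
  let f : Matrix (Fin n) (Fin n) ℚ_[p] → ℝ≥0∞ := fun z =>
    ENNReal.ofReal ((cConst p n (s + 2 * n))⁻¹ * gammaM vol z ^ (-(s + 2 * n)))
  have hf : Measurable f := by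
    have := measurable_gammaM vol
    fun_prop
  have hdet : Measurable fun z : Matrix (Fin n) (Fin n) ℚ_[p] => ‖z.det‖ :=
    (by fun_prop : Continuous fun z : Matrix (Fin n) (Fin n) ℚ_[p] => ‖z.det‖).measurable
  let h : Matrix (Fin n) (Fin n) ℚ_[p] → ℝ≥0∞ := fun z => ENNReal.ofReal (‖z.det‖ ^ s)
  have hh : Measurable h := by fun_prop
  let r : Matrix (Fin n) (Fin n) ℚ_[p] → ℝ≥0∞ := fun z => ENNReal.ofReal (‖z.det‖ ^ n)
  have hr : Measurable r := by fun_prop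
  have hμ : huaMeasure p n s vol = vol.withDensity f := by
    refine withDensity_congr_ae ?_
    filter_upwards [hae] with z hz
    simp only [f, gammaM_eq vol hnorm' hz]
  have hwr : ∀ z : Matrix (Fin n) (Fin n) ℚ_[p], z.det ≠ 0 → wFn z * r z = 1 := by
    intro z hz
    have : 0 < ‖z.det‖ := norm_pos_iff.2 hz
    simp only [wFn, r]
    rw [← ENNReal.ofReal_mul (by positivity), inv_mul_cancel₀ (by positivity), ENNReal.ofReal_one]
  -- behaviour of the density under inversion
  have hinv : ∀ z : Matrix (Fin n) (Fin n) ℚ_[p], z.det ≠ 0 →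
      wFn z * (r z⁻¹ * f z⁻¹) = f z * h z := by
    intro z hz
    have hp : 0 < ‖z.det‖ := norm_pos_iff.2 hz
    have hdi : (z⁻¹).det = (z.det)⁻¹ := by
      rw [Matrix.det_nonsing_inv, Ring.inverse_eq_inv']
    have hz' : (z⁻¹).det ≠ 0 := by rw [hdi]; exact inv_ne_zero hz
    simp only [wFn, r, f, h]
    rw [gammaM_eq vol hnorm' hz, gammaM_eq vol hnorm' hz', gammaFn_inv vol hnorm' hz, hdi, norm_inv,
      ← ENNReal.ofReal_mul (by positivity), ← ENNReal.ofReal_mul (by positivity),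
      ← ENNReal.ofReal_mul' (by positivity)]
    congr 1
    have hg := gammaFn_pos z
    rw [Real.div_rpow hg.le hp.le]
    have e1 : ‖z.det‖ ^ (-(s + 2 * (n : ℝ))) = (‖z.det‖ ^ s)⁻¹ * (‖z.det‖ ^ n)⁻¹ * (‖z.det‖ ^ n)⁻¹ := by
      rw [show -(s + 2 * (n : ℝ)) = -s + -(n : ℝ) + -(n : ℝ) by ring, Real.rpow_add hp,
        Real.rpow_add hp, Real.rpow_neg hp.le, Real.rpow_neg hp.le, Real.rpow_natCast]
    rw [e1, inv_pow]
    have : 0 < ‖z.det‖ ^ s := Real.rpow_pos_of_pos hp s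
    field_simp
  have hmap : Measure.map (fun z : Matrix (Fin n) (Fin n) ℚ_[p] => z⁻¹) (vol.withDensity f) =
      (vol.withDensity f).withDensity h := by
    rw [← withDensity_mul vol hf hh]
    ext E hE
    have hEi : Measurable (E.indicator (1 : Matrix (Fin n) (Fin n) ℚ_[p] → ℝ≥0∞)) :=
      measurable_one.indicator hE
    have hEi' : Measurable (fun z : Matrix (Fin n) (Fin n) ℚ_[p] =>
        E.indicator (1 : Matrix (Fin n) (Fin n) ℚ_[p] → ℝ≥0∞) z⁻¹) := hEi.comp measurable_matInv
    have hI : ∀ (μ : Measure (Matrix (Fin n) (Fin n) ℚ_[p])),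
        μ E = ∫⁻ z, E.indicator 1 z ∂μ := fun μ => (lintegral_indicator_one hE).symm
    rw [hI, hI, lintegral_map hEi measurable_matInv,
      lintegral_withDensity_eq_lintegral_mul vol hf hEi',
      lintegral_withDensity_eq_lintegral_mul vol (hf.mul hh) hEi]
    have hm1 : Measurable fun z : Matrix (Fin n) (Fin n) ℚ_[p] =>
        r z⁻¹ * f z⁻¹ * E.indicator 1 z :=
      ((hr.comp measurable_matInv).mul (hf.comp measurable_matInv)).mul hEi
    have hm2 : Measurable fun z : Matrix (Fin n) (Fin n) ℚ_[p] =>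
        r z⁻¹⁻¹ * f z⁻¹⁻¹ * E.indicator 1 z⁻¹ := hm1.comp measurable_matInv
    have hk := nuM_inv vol hnorm' hm1
    rw [lintegral_nuM vol hm1, lintegral_nuM vol hm2] at hk
    refine Eq.trans (lintegral_congr_ae ?_) (hk.trans (lintegral_congr_ae ?_))
    · filter_upwards [hae] with z hz
      simp only [Pi.mul_apply]
      rw [Matrix.nonsing_inv_nonsing_inv _ (isUnit_iff_ne_zero.2 hz), ← mul_assoc, ← mul_assoc,
        hwr z hz, one_mul]
    · filter_upwards [hae] with z hz
      simp only [Pi.mul_apply]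
      rw [← mul_assoc, hinv z hz]
  rw [hμ]
  exact hmap
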